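/- Let S and A be finite nonempty sets, let P_1,…,P_K be transition kernels on (S,A) whose neighboring sets coincide (N_{P_1}^s = ⋯ = N_{P_K}^s for every s ∈ S), r : S × A → [0,1] a reward, γ ∈ (0,1), ω ∈ [0,1), E ≥ 1 an integer, λ_t = 2/((1−γ)(t+E)) with λ_t ≤ 1, and Q* a fixed point of the averaged operator (1/K)Σ_k T_{P_k,ω}. Suppose that for some t_0 with t−E+1 ≤ t_0 ≤ t all agents are synchronized at step t_0 (Q^k_{t_0} = Q̄_{t_0} for all k), that Q^k_{t'+1} = (1−λ_{t'}) Q^k_{t'} + λ_{t'} T_{P_k,ω} Q^k_{t'} for t' = t_0,…,t−1, and that 0 ≤ Q^k_{t'}(s,a) ≤ 1/(1−γ) for all iterates. Then, with Q̄_t = (1/K)Σ_k Q^k_t and Q̄_{t+1} = (1/K)Σ_k [(1−λ_t)Q^k_t + λ_t T_{P_k,ω} Q^k_t], ‖Q̄_{t+1} − Q*‖_∞ ≤ (1 − (1−γ)λ_t) ‖Q̄_t − Q*‖_∞ + 4 γ λ_t^2 (E−1)/(1−γ). -/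

import Mathlib

open Finset

/-- `P` is a transition kernel on `(S, A)`: nonnegative entries and each
`P (s) (a) (·)` sums to one. -/
def IsKernel {S A : Type*} [Fintype S] (P : S → A → S → ℝ) : Prop :=
  (∀ s a s', 0 ≤ P s a s') ∧ (∀ s a, ∑ s', P s a s' = 1)

/-- `max_{a'} Q(s, a')` over the finite nonempty action set. -/
noncomputable def maxA {S A : Type*} [Fintype A] [Nonempty A] (Q : S → A → ℝ) (s : S) : ℝ :=
  Finset.univ.sup' Finset.univ_nonempty (Q s)

open scoped Classical in
/-- The neighboring set `N_P^s = { s' : ∑_a P(s'|s,a) ≠ 0 }`. -/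
noncomputable def nbr {S A : Type*} [Fintype S] [Fintype A] (P : S → A → S → ℝ) (s : S) :
    Finset S :=
  Finset.univ.filter (fun s' => ∑ a, P s a s' ≠ 0)

/-- The robust Bellman operator `T_{P,ω}`. The minimum over the (nonempty, finite)
neighboring set is expressed via `sInf` of the image. -/
noncomputable def bellman {S A : Type*} [Fintype S] [Fintype A] [Nonempty A]
    (P : S → A → S → ℝ) (r : S → A → ℝ) (γ ω : ℝ) (Q : S → A → ℝ) : S → A → ℝ :=
  fun s a => r s a + γ * ((1 - ω) * ∑ s', P s a s' * maxA Q s'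
    + ω * sInf ((fun s' => maxA Q s') '' (nbr P s : Set S)))

/-- The sup norm `‖Q‖_∞ = max_{(s,a)} |Q(s,a)|`. -/
noncomputable def supNorm {S A : Type*} [Fintype S] [Fintype A] [Nonempty S] [Nonempty A]
    (Q : S → A → ℝ) : ℝ :=
  Finset.univ.sup' Finset.univ_nonempty (fun p : S × A => |Q p.1 p.2|)

lemma abs_average_le {K : ℕ} (hK : 0 < K) {x : Fin K → ℝ} {c : ℝ} (h : ∀ k, |x k| ≤ c) :
    |(1 / (K : ℝ)) * ∑ k, x k| ≤ c := by
  have hK' : (0 : ℝ) < K := by exact_mod_cast hK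
  have hsum : |∑ k, x k| ≤ K * c :=
    (Finset.abs_sum_le_sum_abs _ _).trans <| by
      simpa using Finset.sum_le_card_nsmul Finset.univ _ c fun k _ => h k
  rw [abs_mul, abs_of_pos (by positivity), one_div, inv_mul_le_iff₀ hK']
  exact hsum

lemma maxA_le_maxA_add {S A : Type*} [Fintype A] [Nonempty A] {Q Q' : S → A → ℝ} {d : ℝ}
    (h : ∀ s a, Q s a ≤ Q' s a + d) (s : S) : maxA Q s ≤ maxA Q' s + d :=
  Finset.sup'_le _ _ fun a _ =>
    (h s a).trans <| by gcongr; exact Finset.le_sup' (Q' s) (Finset.mem_univ a)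

lemma sInf_image_le_add {S : Type*} {f g : S → ℝ} {d : ℝ} (hd : 0 ≤ d)
    (h : ∀ s, f s ≤ g s + d) (N : Finset S) :
    sInf (f '' (N : Set S)) ≤ sInf (g '' (N : Set S)) + d := by
  rcases N.eq_empty_or_nonempty with rfl | hN
  · simpa using hd
  · rw [← sub_le_iff_le_add]
    refine le_csInf ((Finset.coe_nonempty.2 hN).image g) ?_
    rintro _ ⟨s, hs, rfl⟩
    have hbdd : BddBelow (f '' (N : Set S)) := (N.finite_toSet.image f).bddBelow
    linarith [csInf_le hbdd (Set.mem_image_of_mem f hs), h s]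

section Bellman

variable {S A : Type*} [Fintype S] [Fintype A] [Nonempty A] {P : S → A → S → ℝ}
  {r : S → A → ℝ} {γ ω : ℝ}

lemma bellman_le_bellman_add (hP : IsKernel P) (hγ : 0 ≤ γ) (hω0 : 0 ≤ ω) (hω1 : ω ≤ 1)
    {Q Q' : S → A → ℝ} {d : ℝ} (hd : 0 ≤ d) (h : ∀ s a, Q s a ≤ Q' s a + d) (s : S) (a : A) :
    bellman P r γ ω Q s a ≤ bellman P r γ ω Q' s a + γ * d := by
  have hmax := maxA_le_maxA_add h
  have hsum : ∑ s', P s a s' * maxA Q s' ≤ ∑ s', P s a s' * maxA Q' s' + d := by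
    calc ∑ s', P s a s' * maxA Q s' ≤ ∑ s', P s a s' * (maxA Q' s' + d) :=
          Finset.sum_le_sum fun s' _ => mul_le_mul_of_nonneg_left (hmax s') (hP.1 s a s')
      _ = _ := by simp only [mul_add, Finset.sum_add_distrib, ← Finset.sum_mul, hP.2, one_mul]
  have hmin := sInf_image_le_add hd hmax (nbr P s)
  have hmix := add_le_add (mul_le_mul_of_nonneg_left hsum (sub_nonneg.2 hω1))
    (mul_le_mul_of_nonneg_left hmin hω0)
  have := mul_le_mul_of_nonneg_left hmix hγ
  unfold bellman
  linarith

lemma abs_bellman_sub_le (hP : IsKernel P) (hγ : 0 ≤ γ) (hω0 : 0 ≤ ω) (hω1 : ω ≤ 1)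
    {Q Q' : S → A → ℝ} {d : ℝ} (hd : 0 ≤ d) (h : ∀ s a, |Q s a - Q' s a| ≤ d) (s : S) (a : A) :
    |bellman P r γ ω Q s a - bellman P r γ ω Q' s a| ≤ γ * d := by
  rw [abs_sub_le_iff, sub_le_iff_le_add', sub_le_iff_le_add']
  constructor <;> refine bellman_le_bellman_add hP hγ hω0 hω1 hd (fun s a => ?_) s a <;>
    linarith [abs_sub_le_iff.1 (h s a)]

lemma bellman_zero : bellman P r γ ω 0 = r := by
  have hmax : maxA (0 : S → A → ℝ) = 0 := by
    funext s
    exact Finset.sup'_const _ (0 : ℝ)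
  have hmin (N : Finset S) : sInf ((fun _ : S => (0 : ℝ)) '' (N : Set S)) = 0 := by
    rcases N.eq_empty_or_nonempty with rfl | hN
    · simp
    · rw [Set.Nonempty.image_const (Finset.coe_nonempty.2 hN), csInf_singleton]
  funext s a
  simp [bellman, hmax, hmin]

lemma bellman_mem_Icc (hP : IsKernel P) (hr : ∀ s a, 0 ≤ r s a ∧ r s a ≤ 1) (hγ0 : 0 ≤ γ)
    (hγ1 : γ < 1) (hω0 : 0 ≤ ω) (hω1 : ω ≤ 1) {Q : S → A → ℝ}
    (hQ : ∀ s a, 0 ≤ Q s a ∧ Q s a ≤ 1 / (1 - γ)) (s : S) (a : A) :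
    0 ≤ bellman P r γ ω Q s a ∧ bellman P r γ ω Q s a ≤ 1 / (1 - γ) := by
  have hγ : 0 < 1 - γ := sub_pos.2 hγ1
  have hlow := bellman_le_bellman_add (r := r) (Q := 0) (Q' := Q) hP hγ0 hω0 hω1 le_rfl
    (by simpa using fun s a => (hQ s a).1) s a
  have hupp := bellman_le_bellman_add (r := r) (Q := Q) (Q' := 0) hP hγ0 hω0 hω1
    (by positivity : 0 ≤ 1 / (1 - γ)) (by simpa using fun s a => (hQ s a).2) s a
  rw [bellman_zero] at hlow hupp
  have hsum : 1 + γ * (1 / (1 - γ)) = 1 / (1 - γ) := by field_simp; ring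
  constructor <;> linarith [hr s a]

end Bellman

lemma abs_le_supNorm {S A : Type*} [Fintype S] [Fintype A] [Nonempty S] [Nonempty A]
    (Q : S → A → ℝ) (s : S) (a : A) : |Q s a| ≤ supNorm Q :=
  Finset.le_sup' (fun p : S × A => |Q p.1 p.2|) (Finset.mem_univ (s, a))

lemma abs_sub_le_of_abs_step_le {u : ℕ → ℝ} {c : ℝ} {t₀ t : ℕ} (ht : t₀ ≤ t)
    (h : ∀ n, t₀ ≤ n → n < t → |u (n + 1) - u n| ≤ c) :
    |u t - u t₀| ≤ ((t : ℝ) - t₀) * c := by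
  induction t, ht using Nat.le_induction with
  | base => simp
  | succ t ht ih =>
    have hlast := h t ht (Nat.lt_succ_self t)
    have hprev := ih fun n h₀ h₁ => h n h₀ (h₁.trans (Nat.lt_succ_self t))
    have htri := abs_sub_le (u (t + 1)) (u t) (u t₀)
    push_cast
    linarith

/-- Within a window of length `E`, the step sizes vary by at most a factor of two. -/
lemma stepsize_le_two_mul {γ : ℝ} (hγ : γ < 1) {E n t : ℕ} (hE : 1 ≤ E) (h : t < n + E) :
    2 / ((1 - γ) * ((n : ℝ) + E)) ≤ 2 * (2 / ((1 - γ) * ((t : ℝ) + E))) := by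
  have hγ' : 0 < 1 - γ := sub_pos.2 hγ
  have hE' : (1 : ℝ) ≤ E := by exact_mod_cast hE
  have ht : (t : ℝ) ≤ n + E := by exact_mod_cast h.le
  have hn : (0 : ℝ) ≤ n := n.cast_nonneg
  rw [← mul_div_assoc, div_le_div_iff₀ (by positivity) (by positivity)]
  nlinarith [mul_le_mul_of_nonneg_left (by linarith : (t : ℝ) + E ≤ 2 * (n + E)) hγ'.le]

/-- combining Lemma 1 and Lemma 2: the averaged FedRQ iterate satisfies
‖Q̄_{t+1} − Q*‖_∞ ≤ (1 − (1−γ)λ_t)‖Q̄_t − Q*‖_∞ + 4γλ_t²(E−1)/(1−γ). -/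
theorem fedRQ_recursive_inequality
    {S A : Type*} [Fintype S] [Fintype A] [Nonempty S] [Nonempty A]
    (K : ℕ) (hK : 0 < K) (P : Fin K → S → A → S → ℝ) (hP : ∀ k, IsKernel (P k))
    (hnbr : ∀ s : S, ∀ k k' : Fin K, nbr (P k) s = nbr (P k') s)
    (r : S → A → ℝ) (hr : ∀ s a, 0 ≤ r s a ∧ r s a ≤ 1)
    (γ ω : ℝ) (hγ0 : 0 < γ) (hγ1 : γ < 1) (hω0 : 0 ≤ ω) (hω1 : ω < 1)
    (E : ℕ) (hE : 1 ≤ E)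
    (lam : ℕ → ℝ) (hlam : ∀ n : ℕ, lam n = 2 / ((1 - γ) * ((n : ℝ) + (E : ℝ))))
    (Qstar : S → A → ℝ)
    (hQstar : (fun s a => (1 / (K : ℝ)) * ∑ k, bellman (P k) r γ ω Qstar s a) = Qstar)
    (Q : ℕ → Fin K → S → A → ℝ)
    (Qbar : ℕ → S → A → ℝ)
    (hQbar : ∀ n, Qbar n = fun s a => (1 / (K : ℝ)) * ∑ k, Q n k s a)
    (t t₀ : ℕ) (ht₀ : t₀ ≤ t) (ht₀' : t < t₀ + E)
    (hlamt : lam t ≤ 1)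
    (hsync : ∀ k, Q t₀ k = Qbar t₀)
    (hstep : ∀ t', t₀ ≤ t' → t' < t → ∀ k, Q (t' + 1) k
      = fun s a => (1 - lam t') * Q t' k s a + lam t' * bellman (P k) r γ ω (Q t' k) s a)
    (hbdd : ∀ t', t₀ ≤ t' → t' ≤ t → ∀ k s a, 0 ≤ Q t' k s a ∧ Q t' k s a ≤ 1 / (1 - γ))
    (Qbar' : S → A → ℝ)
    (hQbar' : Qbar' = fun s a => (1 / (K : ℝ)) *
      ∑ k, ((1 - lam t) * Q t k s a + lam t * bellman (P k) r γ ω (Q t k) s a)) :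
    supNorm (Qbar' - Qstar) ≤ (1 - (1 - γ) * lam t) * supNorm (Qbar t - Qstar)
      + 4 * γ * (lam t) ^ 2 * ((E : ℝ) - 1) / (1 - γ) := by
  have hγ : 0 < 1 - γ := sub_pos.2 hγ1
  have hE' : (1 : ℝ) ≤ E := by exact_mod_cast hE
  have hK' : (K : ℝ) ≠ 0 := by exact_mod_cast hK.ne'
  have hlam0 (n : ℕ) : 0 ≤ lam n := by rw [hlam]; positivity
  set c : ℝ := 2 * lam t * (1 / (1 - γ)) with hc
  have hc0 : 0 ≤ c := by have := hlam0 t; positivity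
  have hdrift (k : Fin K) (s : S) (a : A) : |Q t k s a - Qbar t₀ s a| ≤ (E - 1) * c := by
    have hwindow : (t : ℝ) - t₀ ≤ E - 1 := by
      have : (t : ℝ) + 1 ≤ t₀ + E := by exact_mod_cast ht₀'
      linarith
    rw [← hsync k]
    refine (abs_sub_le_of_abs_step_le (u := fun n => Q n k s a) ht₀ fun n h₀ h₁ => ?_).trans
      (mul_le_mul_of_nonneg_right hwindow hc0)
    have hT := bellman_mem_Icc (hP k) hr hγ0.le hγ1 hω0 hω1.le (hbdd n h₀ h₁.le k) s a
    have hQ := hbdd n h₀ h₁.le k s a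
    have hstep' : Q (n + 1) k s a - Q n k s a
        = lam n * (bellman (P k) r γ ω (Q n k) s a - Q n k s a) := by
      rw [hstep n h₀ h₁ k]; ring
    have hlam2 : lam n ≤ 2 * lam t := by
      rw [hlam, hlam]
      exact stepsize_le_two_mul hγ1 hE (by omega)
    rw [hstep', abs_mul, abs_of_nonneg (hlam0 n)]
    refine mul_le_mul hlam2 ?_ (abs_nonneg _) ((hlam0 n).trans hlam2)
    rw [abs_sub_le_iff]
    constructor <;> linarith
  have hdriftbar (s : S) (a : A) : |Qbar t s a - Qbar t₀ s a| ≤ (E - 1) * c := by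
    have havg := abs_average_le hK fun k => hdrift k s a
    rw [Finset.sum_sub_distrib, mul_sub] at havg
    simpa [hQbar t, hK'] using havg
  set M := supNorm (Qbar t - Qstar)
  have hM0 : 0 ≤ M :=
    (abs_nonneg _).trans (abs_le_supNorm _ (Classical.arbitrary S) (Classical.arbitrary A))
  have hdist (k : Fin K) (s : S) (a : A) :
      |Q t k s a - Qstar s a| ≤ M + 2 * ((E - 1) * c) := by
    have h₁ := abs_sub_le (Q t k s a) (Qbar t₀ s a) (Qstar s a)
    have h₂ := abs_sub_le (Qbar t₀ s a) (Qbar t s a) (Qstar s a)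
    have h₃ : |Qbar t s a - Qstar s a| ≤ M := abs_le_supNorm (Qbar t - Qstar) s a
    have h₄ := hdriftbar s a
    rw [abs_sub_comm] at h₄
    linarith [hdrift k s a]
  have hd0 : 0 ≤ M + 2 * ((E - 1) * c) := by
    have : 0 ≤ (E : ℝ) - 1 := sub_nonneg.2 hE'
    positivity
  refine Finset.sup'_le _ _ ?_
  rintro ⟨s, a⟩ -
  have hsplit : (Qbar' - Qstar) s a = (1 - lam t) * (Qbar t s a - Qstar s a)
      + lam t * ((1 / (K : ℝ)) *
        ∑ k, (bellman (P k) r γ ω (Q t k) s a - bellman (P k) r γ ω Qstar s a)) := by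
    have hfix := congrFun (congrFun hQstar s) a
    simp only [Pi.sub_apply, hQbar', hQbar t, Finset.sum_add_distrib, Finset.sum_sub_distrib,
      ← Finset.mul_sum] at hfix ⊢
    linear_combination lam t * hfix
  have hbell := abs_average_le hK fun k =>
    abs_bellman_sub_le (r := r) (hP k) hγ0.le hω0 hω1.le hd0 (hdist k) s a
  have hbar : |Qbar t s a - Qstar s a| ≤ M := abs_le_supNorm (Qbar t - Qstar) s a
  change |(Qbar' - Qstar) s a| ≤ _
  rw [hsplit]
  refine (abs_add_le _ _).trans ?_
  rw [abs_mul, abs_mul, abs_of_nonneg (sub_nonneg.2 hlamt), abs_of_nonneg (hlam0 t)]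
  refine (add_le_add (mul_le_mul_of_nonneg_left hbar (sub_nonneg.2 hlamt))
    (mul_le_mul_of_nonneg_left hbell (hlam0 t))).trans_eq ?_
  rw [hc]
  ring
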